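/- Let e_a(z) = z^a on the unit circle with the branch cut at z = -1 (i.e. e_a(e^{iφ}) = e^{iaφ} for -π < φ ≤ π). For half-odd integers r ∈ ℕ₀ + 1/2 and positive integers n, the inner product ∫_{-π}^{-π/2} e^{i(2n+1+r)φ} dφ/2π + i∫_{-π/2}^{π/2} e^{i(2n+2+r)φ} dφ/2π - ∫_{π/2}^{π} e^{i(2n+1+r)φ} dφ/2π equals (i(-1)^n/π) · sin(rπ/2) · 1/((2n+1+r)(2n+2+r)). -/

import Mathlib

open Complex intervalIntegral

/-- `e^{-iaφ}` and `e^{iaφ}` in terms of real sine and cosine. -/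
lemma exp_I_real (a x : ℝ) :
    Complex.exp (Complex.I * (a : ℂ) * (x : ℂ))
      = ((Real.cos (a * x) : ℝ) : ℂ) + ((Real.sin (a * x) : ℝ) : ℂ) * Complex.I := by
  rw [Complex.ofReal_cos, Complex.ofReal_sin, ← Complex.exp_mul_I]
  congr 1
  push_cast
  ring

lemma int_exp (a x y : ℝ) (ha : a ≠ 0) :
    (∫ φ : ℝ in x..y, Complex.exp (Complex.I * (a : ℂ) * (φ : ℂ)))
      = (((Real.cos (a * y) : ℝ) : ℂ) + ((Real.sin (a * y) : ℝ) : ℂ) * Complex.I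
        - (((Real.cos (a * x) : ℝ) : ℂ) + ((Real.sin (a * x) : ℝ) : ℂ) * Complex.I))
        / (Complex.I * (a : ℂ)) := by
  have h : Complex.I * (a : ℂ) ≠ 0 :=
    mul_ne_zero Complex.I_ne_zero (Complex.ofReal_ne_zero.mpr ha)
  rw [integral_exp_mul_complex h, exp_I_real, exp_I_real]

/-- Fourier-integral computation of `⟨e_{-r}, V' e_{2n+1}⟩` with `r = m + 1/2`:
`∫_{-π}^{-π/2} e^{i(2n+1+r)φ} dφ/2π + i∫_{-π/2}^{π/2} e^{i(2n+2+r)φ} dφ/2π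
  - ∫_{π/2}^{π} e^{i(2n+1+r)φ} dφ/2π = (i(-1)ⁿ/π)·sin(rπ/2)/((2n+1+r)(2n+2+r))`. -/
theorem stmt_6 (m n : ℕ) (hn : 1 ≤ n) :
    (∫ φ : ℝ in (-Real.pi)..(-(Real.pi / 2)),
        Complex.exp (Complex.I * ((2 * (n : ℝ) + 1 + ((m : ℝ) + 1 / 2) : ℝ) : ℂ) * (φ : ℂ)))
        / (2 * (Real.pi : ℂ))
    + Complex.I * (∫ φ : ℝ in (-(Real.pi / 2))..(Real.pi / 2),
        Complex.exp (Complex.I * ((2 * (n : ℝ) + 2 + ((m : ℝ) + 1 / 2) : ℝ) : ℂ) * (φ : ℂ)))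
        / (2 * (Real.pi : ℂ))
    - (∫ φ : ℝ in (Real.pi / 2)..Real.pi,
        Complex.exp (Complex.I * ((2 * (n : ℝ) + 1 + ((m : ℝ) + 1 / 2) : ℝ) : ℂ) * (φ : ℂ)))
        / (2 * (Real.pi : ℂ))
    = Complex.I * (-1) ^ n / (Real.pi : ℂ)
        * ((Real.sin (((m : ℝ) + 1 / 2) * Real.pi / 2) : ℝ) : ℂ)
        * (1 / (((2 * (n : ℝ) + 1 + ((m : ℝ) + 1 / 2) : ℝ) : ℂ)
              * ((2 * (n : ℝ) + 2 + ((m : ℝ) + 1 / 2) : ℝ) : ℂ))) := by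
  set r : ℝ := (m : ℝ) + 1 / 2 with hr
  have hr0 : 0 < r := by positivity
  set A : ℝ := 2 * (n : ℝ) + 1 + r with hA
  set B : ℝ := 2 * (n : ℝ) + 2 + r with hB
  have hA0 : A ≠ 0 := by positivity
  have hB0 : B ≠ 0 := by positivity
  have hBA : B = A + 1 := by rw [hA, hB]; ring
  have c1 : Real.cos (A * Real.pi) = 0 := by
    rw [Real.cos_eq_zero_iff]
    refine ⟨2 * n + 1 + m, ?_⟩
    rw [hA, hr]; push_cast; ring
  have c2 : Real.cos (A * (Real.pi / 2)) = -((-1) ^ n * Real.sin (r * Real.pi / 2)) := by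
    have : A * (Real.pi / 2) = (r * Real.pi / 2 + Real.pi / 2) + n * Real.pi := by
      rw [hA]; ring
    rw [this, Real.cos_add_nat_mul_pi, Real.cos_add_pi_div_two]; ring
  have s2 : Real.sin (B * (Real.pi / 2)) = -((-1) ^ n * Real.sin (r * Real.pi / 2)) := by
    have : B * (Real.pi / 2) = (r * Real.pi / 2 + Real.pi) + n * Real.pi := by
      rw [hB]; ring
    rw [this, Real.sin_add_nat_mul_pi, Real.sin_add_pi]; ring
  rw [int_exp A _ _ hA0, int_exp B _ _ hB0, int_exp A _ _ hA0]
  simp only [mul_neg, Real.cos_neg, Real.sin_neg]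
  rw [c1, c2, s2]
  have hAc : (A : ℂ) ≠ 0 := Complex.ofReal_ne_zero.mpr hA0
  have hBc : (B : ℂ) ≠ 0 := Complex.ofReal_ne_zero.mpr hB0
  have hpi : (Real.pi : ℂ) ≠ 0 := Complex.ofReal_ne_zero.mpr Real.pi_ne_zero
  have hI : Complex.I ≠ 0 := Complex.I_ne_zero
  have hBAc : (B : ℂ) = A + 1 := by rw [hBA]; push_cast; ring
  clear_value A B r
  generalize Real.sin (r * Real.pi / 2) = s
  generalize Real.sin (A * Real.pi) = t
  generalize Real.sin (A * (Real.pi / 2)) = u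
  generalize Real.cos (B * (Real.pi / 2)) = v
  push_cast
  generalize ((-1 : ℂ)) ^ n = e
  field_simp
  rw [hBAc]
  have hI2 := Complex.I_sq
  linear_combination (-2 * e * s - 2 * e * s * A) * hI2
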